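/- Sufficiency in the Carleson embedding theorem for vector-valued Bergman spaces: let G : 𝔻 → B(H) be integrable nonnegative operator-valued, W an operator-valued B₂(η) weight (η > −1), r ∈ (0,1), n ≥ 0. If ∫_{D_{λ,r}} G dA ≤ C (1−|λ|)^{2n} ∫_{D_{λ,r}} W dA_η for all λ ∈ 𝔻, then for every f ∈ L²_a(H, W dA_η): ∫_𝔻 ⟨G(z) f^{(n)}(z), f^{(n)}(z)⟩ dA(z) ≲ ∫_𝔻 ⟨W(z) f(z), f(z)⟩ dA_η(z). -/

import Mathlib

open MeasureTheory Metric Complex Set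
open scoped ENNReal NNReal InnerProductSpace

noncomputable section

/-- Normalized Lebesgue area measure on the unit disc. -/
def areaM : Measure ℂ := (ENNReal.ofReal Real.pi)⁻¹ • (volume.restrict (ball (0:ℂ) 1))

/-- The dyadic arc of level `n`, index `k` (half-open parametrization). -/
def dyadicArc (n k : ℕ) : Set ℂ :=
  {z | ∃ t : ℝ, 2 * Real.pi * k / 2 ^ n ≤ t ∧ t < 2 * Real.pi * (k + 1) / 2 ^ n ∧
    z = Complex.exp (t * Complex.I)}

/-- The Carleson square over the dyadic arc of level `n`, index `k`. -/
def carlesonBox (n k : ℕ) : Set ℂ :=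
  {z | ‖z‖ < 1 ∧ (z / (‖z‖ : ℂ)) ∈ dyadicArc n k ∧ 1 - 1 / 2 ^ n ≤ ‖z‖}

/-- The top half of the Carleson square. -/
def topHalf (n k : ℕ) : Set ℂ :=
  {z | z ∈ carlesonBox n k ∧ ‖z‖ < 1 - 1 / 2 ^ (n + 1)}

/-- The disc `D_{z,r}` of radius `r(1-|z|)` centered at `z`, inside the unit disc. -/
def discAt (z : ℂ) (r : ℝ) : Set ℂ :=
  {ζ : ℂ | ‖ζ‖ < 1 ∧ ‖ζ - z‖ < r * (1 - ‖z‖)}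

variable {H : Type*} [NormedAddCommGroup H] [InnerProductSpace ℂ H] [CompleteSpace H]

/-- `T` is the weak (Pettis) integral of the operator-valued function `F` over `S`
with respect to `ν`. -/
def IsWeakOpIntegral (ν : Measure ℂ) (F : ℂ → H →L[ℂ] H) (S : Set ℂ)
    (T : H →L[ℂ] H) : Prop :=
  ∀ x y : H, Integrable (fun z => (⟪F z x, y⟫_ℂ)) (ν.restrict S) ∧
    (⟪T x, y⟫_ℂ) = ∫ z in S, ⟪F z x, y⟫_ℂ ∂ν

/-- The weighted area measure `dA_η = (η+1)(1−|z|)^η dA`. -/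
def measAeta (η : ℝ) : Measure ℂ :=
  areaM.withDensity fun z => ENNReal.ofReal ((η + 1) * (1 - ‖z‖) ^ η)

/-- A (non-dyadic) Carleson square `S = {ρ e^{it} : 1−h < ρ < 1, |t−θ| < πh}`. -/
def carlesonSquare (h θ : ℝ) : Set ℂ :=
  {z | ∃ ρ t : ℝ, 1 - h < ρ ∧ ρ < 1 ∧ |t - θ| < Real.pi * h ∧
    z = (ρ : ℂ) * Complex.exp (t * Complex.I)}

/-- `W` (with pointwise inverse `Winv`) is an operator-valued Békollé–Bonami `B₂(η)`
weight: a.e. nonnegative and invertible, with `(1−|z|)^η W` and `(1−|z|)^η W⁻¹` weakly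
integrable on `𝔻`, `∫ W dA_η` invertible, and the `B₂(η)` condition (formulated via the
positive square roots of the normalized averages over Carleson squares). -/
def IsB2Weight (η : ℝ) (W Winv : ℂ → H →L[ℂ] H) : Prop :=
  (∀ᵐ z ∂areaM, (W z).IsPositive ∧ W z ∘L Winv z = 1 ∧ Winv z ∘L W z = 1) ∧
  (∃ TW : H →L[ℂ] H, IsWeakOpIntegral (measAeta η) W (ball (0 : ℂ) 1) TW ∧ IsUnit TW) ∧
  (∃ TWi : H →L[ℂ] H, IsWeakOpIntegral (measAeta η) Winv (ball (0 : ℂ) 1) TWi) ∧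
  ∃ c : ℝ, ∀ h θ : ℝ, 0 < h → h < 1 → 0 ≤ θ → θ < 2 * Real.pi →
    ∀ P Q Ps Qs : H →L[ℂ] H,
      IsWeakOpIntegral (measAeta η) W (carlesonSquare h θ) P →
      IsWeakOpIntegral (measAeta η) Winv (carlesonSquare h θ) Q →
      Ps.IsPositive → Qs.IsPositive →
      Ps ∘L Ps = ((measAeta η (carlesonSquare h θ)).toReal⁻¹) • P →
      Qs ∘L Qs = ((measAeta η (carlesonSquare h θ)).toReal⁻¹) • Q →
      ‖Ps ∘L Qs‖ ≤ c


section OpLemmas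

set_option linter.unusedSectionVars false

variable {K : Type*} [NormedAddCommGroup K] [InnerProductSpace ℂ K] [CompleteSpace K]

lemma exists_pos_sqrt (T : K →L[ℂ] K) (hT : T.IsPositive) :
    ∃ S : K →L[ℂ] K, S.IsPositive ∧ S ∘L S = T := by
  have h0 : 0 ≤ T := (ContinuousLinearMap.nonneg_iff_isPositive T).2 hT
  refine ⟨CFC.sqrt T, (ContinuousLinearMap.nonneg_iff_isPositive _).1 (CFC.sqrt_nonneg T), ?_⟩
  exact CFC.sqrt_mul_sqrt_self T h0

lemma reApply_of_sq {T S : K →L[ℂ] K} (hS : S.IsPositive) (h : S ∘L S = T) (x : K) :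
    T.reApplyInnerSelf x = ‖S x‖ ^ 2 := by
  rw [ContinuousLinearMap.reApplyInnerSelf_apply, ← h, ContinuousLinearMap.comp_apply,
    hS.inner_left_eq_inner_right, inner_self_eq_norm_sq]

lemma inner_amgm {T : K →L[ℂ] K} (hT : T.IsPositive) (x y : K) {t : ℝ} (ht : 0 < t) :
    2 * ‖⟪T x, y⟫_ℂ‖ ≤ t * T.reApplyInnerSelf x + t⁻¹ * T.reApplyInnerSelf y := by
  obtain ⟨S, hS, h⟩ := exists_pos_sqrt T hT
  rw [reApply_of_sq hS h, reApply_of_sq hS h]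
  have : ⟪T x, y⟫_ℂ = ⟪S x, S y⟫_ℂ := by
    rw [← h, ContinuousLinearMap.comp_apply, hS.inner_left_eq_inner_right]
  rw [this]
  have h1 : ‖⟪S x, S y⟫_ℂ‖ ≤ ‖S x‖ * ‖S y‖ := norm_inner_le_norm _ _
  have h2 : t * ‖S x‖ ^ 2 + t⁻¹ * ‖S y‖ ^ 2 - 2 * (‖S x‖ * ‖S y‖)
      = t⁻¹ * (t * ‖S x‖ - ‖S y‖) ^ 2 := by
    field_simp; ring
  have h3 : 0 ≤ t⁻¹ * (t * ‖S x‖ - ‖S y‖) ^ 2 := by positivity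
  linarith

/-- Positive operators: `‖T x‖² ≤ ‖T‖ ⟨T x, x⟩`. -/
lemma norm_sq_le_of_pos {T : K →L[ℂ] K} (hT : T.IsPositive) (x : K) :
    ‖T x‖ ^ 2 ≤ ‖T‖ * T.reApplyInnerSelf x := by
  obtain ⟨S, hS, h⟩ := exists_pos_sqrt T hT
  rw [reApply_of_sq hS h]
  have hn : ‖T‖ = ‖S‖ ^ 2 := by
    have := ContinuousLinearMap.norm_adjoint_comp_self S
    rw [hS.isSelfAdjoint.adjoint_eq, h] at this
    rw [this]; ring
  have h1 : ‖T x‖ ≤ ‖S‖ * ‖S x‖ := by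
    rw [← h]; exact S.le_opNorm _
  rw [hn]
  calc ‖T x‖ ^ 2 ≤ (‖S‖ * ‖S x‖) ^ 2 := by gcongr
    _ = _ := by ring

lemma reApply_le_norm (T : K →L[ℂ] K) (x : K) : T.reApplyInnerSelf x ≤ ‖T‖ * ‖x‖ ^ 2 := by
  rw [ContinuousLinearMap.reApplyInnerSelf_apply]
  calc _ ≤ ‖⟪T x, x⟫_ℂ‖ := RCLike.re_le_norm _
    _ ≤ ‖T x‖ * ‖x‖ := norm_inner_le_norm _ _
    _ ≤ (‖T‖ * ‖x‖) * ‖x‖ := by gcongr; exact T.le_opNorm x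
    _ = _ := by ring

lemma inv_pos_op {A B : K →L[ℂ] K} (hA : A.IsPositive) (hAB : A ∘L B = 1) (x : K) :
    B.reApplyInnerSelf x = A.reApplyInnerSelf (B x) := by
  rw [ContinuousLinearMap.reApplyInnerSelf_apply, ContinuousLinearMap.reApplyInnerSelf_apply]
  have : A (B x) = x := by
    have := congrArg (fun T : K →L[ℂ] K => T x) hAB
    simpa using this
  rw [hA.inner_left_eq_inner_right, this]

lemma inv_isPositive {A B : K →L[ℂ] K} (hA : A.IsPositive) (hAB : A ∘L B = 1) : B.IsPositive := by
  have key : ∀ x, A (B x) = x := fun x => by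
    have := congrArg (fun T : K →L[ℂ] K => T x) hAB
    simpa using this
  refine ⟨fun x y => ?_, fun x => ?_⟩
  · change ⟪B x, y⟫_ℂ = ⟪x, B y⟫_ℂ
    conv_lhs => rw [← key y]
    rw [← hA.inner_left_eq_inner_right, key]
  · rw [inv_pos_op hA hAB]
    exact hA.2 _

/-- Young's inequality for the pairing through a weight and its inverse. -/
lemma pairing_amgm {A B : K →L[ℂ] K} (hA : A.IsPositive) (hAB : A ∘L B = 1)
    (x e : K) {t : ℝ} (ht : 0 < t) :
    2 * ‖⟪x, e⟫_ℂ‖ ≤ t * A.reApplyInnerSelf x + t⁻¹ * B.reApplyInnerSelf e := by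
  have key : ∀ x, A (B x) = x := fun x => by
    have := congrArg (fun T : K →L[ℂ] K => T x) hAB
    simpa using this
  have := inner_amgm hA x (B e) ht
  rw [← inv_pos_op hA hAB, hA.inner_left_eq_inner_right, key] at this
  exact this

lemma b2_op {P Q Ps Qs : K →L[ℂ] K} {m c : ℝ} (hm : 0 < m)
    (hPs : Ps.IsPositive) (hQs : Qs.IsPositive) (h1 : Ps ∘L Ps = m⁻¹ • P) (h2 : Qs ∘L Qs = m⁻¹ • Q)
    (hc : ‖Ps ∘L Qs‖ ≤ c) (y : K) :
    Q.reApplyInnerSelf (P y) ≤ c ^ 2 * m ^ 2 * P.reApplyInnerSelf y := by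
  have hsm : ∀ (T : K →L[ℂ] K) (x : K), (m⁻¹ • T).reApplyInnerSelf x = m⁻¹ * T.reApplyInnerSelf x := by
    intro T x
    rw [ContinuousLinearMap.reApplyInnerSelf_apply, ContinuousLinearMap.reApplyInnerSelf_apply]
    rw [smul_apply, inner_smul_left_eq_smul]
    simp
  have hP := reApply_of_sq hPs h1 y
  have hQ := reApply_of_sq hQs h2 (P y)
  rw [hsm] at hP hQ
  have hPy : P y = m • Ps (Ps y) := by
    have := congrArg (fun T : K →L[ℂ] K => m • T y) h1
    simp only [ContinuousLinearMap.comp_apply, smul_apply] at this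
    rw [this, smul_smul, mul_inv_cancel₀ hm.ne', one_smul]
  have hc0 : 0 ≤ c := le_trans (norm_nonneg _) hc
  have hc' : ‖Qs ∘L Ps‖ ≤ c := by
    have : ContinuousLinearMap.adjoint (Ps ∘L Qs) = Qs ∘L Ps := by
      rw [ContinuousLinearMap.adjoint_comp, hPs.isSelfAdjoint.adjoint_eq,
        hQs.isSelfAdjoint.adjoint_eq]
    rw [← this, LinearIsometryEquiv.norm_map]; exact hc
  have hn : ‖Qs (P y)‖ ≤ m * (c * ‖Ps y‖) := by
    have e : Qs (P y) = m • (Qs ∘L Ps) (Ps y) := by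
      rw [hPy]; simp
    rw [e, norm_smul, Real.norm_of_nonneg hm.le]
    gcongr
    exact ((Qs ∘L Ps).le_opNorm _).trans (by gcongr)
  have hQ' : Q.reApplyInnerSelf (P y) = m * ‖Qs (P y)‖ ^ 2 := by
    rw [← hQ]; field_simp
  have hP' : P.reApplyInnerSelf y = m * ‖Ps y‖ ^ 2 := by
    rw [← hP]; field_simp
  rw [hQ', hP']
  calc m * ‖Qs (P y)‖ ^ 2 ≤ m * (m * (c * ‖Ps y‖)) ^ 2 := by gcongr
    _ = _ := by ring

end OpLemmas

section WeakInt

set_option linter.unusedSectionVars false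

variable {K : Type*} [NormedAddCommGroup K] [InnerProductSpace ℂ K] [CompleteSpace K]

lemma areaM_restrict_ball : areaM.restrict (ball (0:ℂ) 1) = areaM := by
  simp [areaM, Measure.restrict_smul, Measure.restrict_restrict measurableSet_ball]

lemma measAeta_restrict_ball (η : ℝ) : (measAeta η).restrict (ball (0:ℂ) 1) = measAeta η := by
  rw [measAeta, restrict_withDensity measurableSet_ball, areaM_restrict_ball]

lemma reApply_integrable {ν : Measure ℂ} {F : ℂ → K →L[ℂ] K}
    (hFint : ∀ x y : K, Integrable (fun z => (⟪F z x, y⟫_ℂ)) ν) (x : K) :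
    Integrable (fun z => (F z).reApplyInnerSelf x) ν := by
  simp only [ContinuousLinearMap.reApplyInnerSelf_apply]
  exact (hFint x x).re

lemma weak_bound {ν : Measure ℂ} {F : ℂ → K →L[ℂ] K} (hpos : ∀ᵐ z ∂ν, (F z).IsPositive)
    (hFint : ∀ x y : K, Integrable (fun z => (⟪F z x, y⟫_ℂ)) ν) {M : ℝ}
    (hM : ∀ x, ∫ z, (F z).reApplyInnerSelf x ∂ν ≤ M * ‖x‖ ^ 2) (x y : K) :
    ∫ z, ‖⟪F z x, y⟫_ℂ‖ ∂ν ≤ M * ‖x‖ * ‖y‖ := by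
  by_cases hx : x = 0
  · simp [hx]
  by_cases hy : y = 0
  · simp [hy]
  have hx' : 0 < ‖x‖ := norm_pos_iff.2 hx
  have hy' : 0 < ‖y‖ := norm_pos_iff.2 hy
  set t := ‖y‖ / ‖x‖ with ht
  have ht0 : 0 < t := by positivity
  have h1 : ∫ z, 2 * ‖⟪F z x, y⟫_ℂ‖ ∂ν ≤
      ∫ z, (t * (F z).reApplyInnerSelf x + t⁻¹ * (F z).reApplyInnerSelf y) ∂ν := by
    apply integral_mono_ae ((hFint x y).norm.const_mul _)
      (((reApply_integrable hFint x).const_mul _).add ((reApply_integrable hFint y).const_mul _))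
    filter_upwards [hpos] with z hz
    exact inner_amgm hz x y ht0
  rw [integral_const_mul, integral_add ((reApply_integrable hFint x).const_mul _)
    ((reApply_integrable hFint y).const_mul _), integral_const_mul, integral_const_mul] at h1
  have h2 : t * ∫ z, (F z).reApplyInnerSelf x ∂ν ≤ t * (M * ‖x‖ ^ 2) := by gcongr; exact hM x
  have h3 : t⁻¹ * ∫ z, (F z).reApplyInnerSelf y ∂ν ≤ t⁻¹ * (M * ‖y‖ ^ 2) := by gcongr; exact hM y
  have h4 : t * (M * ‖x‖ ^ 2) = M * ‖x‖ * ‖y‖ := by rw [ht]; field_simp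
  have h5 : t⁻¹ * (M * ‖y‖ ^ 2) = M * ‖x‖ * ‖y‖ := by rw [ht]; field_simp
  linarith

lemma weak_exists {ν : Measure ℂ} {F : ℂ → K →L[ℂ] K} (hpos : ∀ᵐ z ∂ν, (F z).IsPositive)
    (hFint : ∀ x y : K, Integrable (fun z => (⟪F z x, y⟫_ℂ)) ν) {M : ℝ}
    (hM : ∀ x, ∫ z, (F z).reApplyInnerSelf x ∂ν ≤ M * ‖x‖ ^ 2) (S : Set ℂ) :
    ∃ T : K →L[ℂ] K, IsWeakOpIntegral ν F S T := by
  have hi : ∀ x y : K, Integrable (fun z => (⟪F z x, y⟫_ℂ)) (ν.restrict S) :=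
    fun x y => (hFint x y).mono_measure Measure.restrict_le_self
  let B0 : K →ₛₗ[starRingEnd ℂ] K →ₗ[ℂ] ℂ :=
    LinearMap.mk₂'ₛₗ (starRingEnd ℂ) (RingHom.id ℂ) (fun x y => ∫ z in S, ⟪F z x, y⟫_ℂ ∂ν)
      (fun x x' y => by
        rw [← integral_add (hi x y) (hi x' y)]; simp)
      (fun c x y => by
        rw [smul_eq_mul, ← integral_const_mul]; simp [mul_comm])
      (fun x y y' => by
        rw [← integral_add (hi x y) (hi x y')]; simp)
      (fun c x y => by
        rw [smul_eq_mul, ← integral_const_mul]; simp)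
  have hB : ∀ x y, ‖B0 x y‖ ≤ M * ‖x‖ * ‖y‖ := by
    intro x y
    calc ‖B0 x y‖ ≤ ∫ z in S, ‖⟪F z x, y⟫_ℂ‖ ∂ν := norm_integral_le_integral_norm _
      _ ≤ ∫ z, ‖⟪F z x, y⟫_ℂ‖ ∂ν :=
        integral_mono_measure Measure.restrict_le_self (by filter_upwards with z; positivity)
          (hFint x y).norm
      _ ≤ _ := weak_bound hpos hFint hM x y
  refine ⟨InnerProductSpace.continuousLinearMapOfBilin (B0.mkContinuous₂ M hB), fun x y =>
    ⟨hi x y, ?_⟩⟩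
  rw [InnerProductSpace.continuousLinearMapOfBilin_apply]
  rfl

lemma weak_exists_of_ball {ν : Measure ℂ} (hν : ν.restrict (ball (0:ℂ) 1) = ν)
    {F : ℂ → K →L[ℂ] K} (hpos : ∀ᵐ z ∂ν, (F z).IsPositive) {T : K →L[ℂ] K}
    (hT : IsWeakOpIntegral ν F (ball (0:ℂ) 1) T) (S : Set ℂ) :
    ∃ T : K →L[ℂ] K, IsWeakOpIntegral ν F S T := by
  unfold IsWeakOpIntegral at hT
  rw [hν] at hT
  refine weak_exists (M := ‖T‖) hpos (fun x y => (hT x y).1) (fun x => ?_) S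
  have : ∫ z, (F z).reApplyInnerSelf x ∂ν = T.reApplyInnerSelf x := by
    simp only [ContinuousLinearMap.reApplyInnerSelf_apply]
    rw [(hT x x).2]
    exact integral_re (hT x x).1
  rw [this]
  exact reApply_le_norm T x

lemma weak_reApply {ν : Measure ℂ} {F : ℂ → K →L[ℂ] K} {S : Set ℂ} {T : K →L[ℂ] K}
    (hT : IsWeakOpIntegral ν F S T) (x : K) :
    T.reApplyInnerSelf x = ∫ z in S, (F z).reApplyInnerSelf x ∂ν := by
  simp only [ContinuousLinearMap.reApplyInnerSelf_apply]
  rw [(hT x x).2]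
  exact (integral_re (hT x x).1).symm

lemma weak_pos {ν : Measure ℂ} {F : ℂ → K →L[ℂ] K} (hpos : ∀ᵐ z ∂ν, (F z).IsPositive)
    {S : Set ℂ} {T : K →L[ℂ] K} (hT : IsWeakOpIntegral ν F S T) : T.IsPositive := by
  have hp : ∀ᵐ z ∂(ν.restrict S), (F z).IsPositive := ae_restrict_of_ae hpos
  refine ⟨fun x y => ?_, fun x => ?_⟩
  · change ⟪T x, y⟫_ℂ = ⟪x, T y⟫_ℂ
    rw [← inner_conj_symm x, (hT x y).2, (hT y x).2, ← integral_conj]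
    apply integral_congr_ae
    filter_upwards [hp] with z hz
    rw [inner_conj_symm, hz.inner_left_eq_inner_right]
  · rw [weak_reApply hT]
    apply integral_nonneg_of_ae
    filter_upwards [hp] with z hz using hz.2 x

lemma weak_lintegral {ν : Measure ℂ} {F : ℂ → K →L[ℂ] K} (hpos : ∀ᵐ z ∂ν, (F z).IsPositive)
    {S : Set ℂ} {T : K →L[ℂ] K} (hT : IsWeakOpIntegral ν F S T) (x : K) :
    ∫⁻ z in S, ENNReal.ofReal ((F z).reApplyInnerSelf x) ∂ν
      = ENNReal.ofReal (T.reApplyInnerSelf x) := by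
  have hp : ∀ᵐ z ∂(ν.restrict S), (F z).IsPositive := ae_restrict_of_ae hpos
  rw [weak_reApply hT]
  refine (ofReal_integral_eq_lintegral_ofReal
    (reApply_integrable (fun x y => (hT x y).1) x) ?_).symm
  filter_upwards [hp] with z hz using hz.2 x

lemma reApply_continuous (T : K →L[ℂ] K) : Continuous T.reApplyInnerSelf := by
  have : T.reApplyInnerSelf = fun x => RCLike.re (⟪T x, x⟫_ℂ) := by
    ext x; rw [ContinuousLinearMap.reApplyInnerSelf_apply]
  rw [this]
  fun_prop

/-- Joint measurability of `(z, ζ) ↦ ⟨F z (g ζ), g ζ⟩`. -/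
lemma joint_aemeasurable {μ ν : Measure ℂ} [SFinite μ] [SFinite ν] {F : ℂ → K →L[ℂ] K}
    (hF : ∀ x, AEMeasurable (fun z => (F z).reApplyInnerSelf x) μ)
    {g : ℂ → K} (hg : StronglyMeasurable g) :
    AEMeasurable (fun p : ℂ × ℂ => (F p.1).reApplyInnerSelf (g p.2)) (μ.prod ν) := by
  refine aemeasurable_of_tendsto_metrizable_ae (u := Filter.atTop)
    (f := fun k p => (F p.1).reApplyInnerSelf (hg.approx k p.2)) ?_ ?_
  · intro k
    have : (fun p : ℂ × ℂ => (F p.1).reApplyInnerSelf (hg.approx k p.2)) =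
      fun p => ∑ v ∈ (hg.approx k).range,
        ((hg.approx k) ⁻¹' {v}).indicator (fun _ => (1:ℝ)) p.2 * (F p.1).reApplyInnerSelf v := by
      ext p
      rw [Finset.sum_eq_single (hg.approx k p.2)]
      · simp
      · intro b _ hb
        rw [Set.indicator_of_notMem (by simpa using hb.symm)]; simp
      · intro h; exact absurd (SimpleFunc.mem_range_self _ _) h
    rw [this]
    refine Finset.aemeasurable_fun_sum _ fun v _ => ?_
    refine AEMeasurable.mul ?_ ?_
    · exact ((measurable_const.indicator ((hg.approx k).measurableSet_preimage _)).comp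
        measurable_snd).aemeasurable
    · exact (hF v).comp_fst
  · filter_upwards with p
    exact ((reApply_continuous (F p.1)).tendsto _).comp (hg.tendsto_approx p.2)

end WeakInt

section MeanValue

set_option linter.unusedSectionVars false

lemma area_mean_value {h : ℂ → ℂ} {w : ℂ} {ρ : ℝ} (hρ : 0 < ρ)
    (hh : DifferentiableOn ℂ h (closedBall w ρ)) :
    ∫ u in ball w ρ, h u = (Real.pi * ρ ^ 2 : ℝ) • h w := by
  have e1 : ∫ u in ball w ρ, h u = ∫ v, (ball (0:ℂ) ρ).indicator (fun v => h (w + v)) v := by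
    rw [← integral_indicator measurableSet_ball]
    rw [← integral_add_left_eq_self (fun u => (ball w ρ).indicator h u) w]
    congr 1
    ext v
    simp [Set.indicator]
  rw [e1, ← Complex.integral_comp_polarCoord_symm]
  have e2 : ∫ p in polarCoord.target, p.1 • (ball (0:ℂ) ρ).indicator (fun v => h (w + v))
      (Complex.polarCoord.symm p) =
      ∫ p in Ioo (0:ℝ) ρ ×ˢ Ioo (-Real.pi) Real.pi, p.1 • h (circleMap w p.1 p.2) := by
    rw [← integral_indicator (by
      rw [polarCoord_target]; exact measurableSet_Ioi.prod measurableSet_Ioo),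
      ← integral_indicator (measurableSet_Ioo.prod measurableSet_Ioo)]
    congr 1
    ext p
    rw [polarCoord_target]
    by_cases h1 : p ∈ Ioi (0:ℝ) ×ˢ Ioo (-Real.pi) Real.pi
    · rw [Set.indicator_of_mem h1]
      have hp0 : 0 < p.1 := h1.1
      have hs : Complex.polarCoord.symm p = p.1 * Complex.exp (p.2 * I) := by
        rw [Complex.polarCoord_symm_apply, Complex.exp_mul_I, Complex.ofReal_cos, Complex.ofReal_sin]
      have hn : ‖Complex.polarCoord.symm p‖ = p.1 := by
        rw [Complex.norm_polarCoord_symm, abs_of_pos hp0]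
      by_cases h2 : p.1 < ρ
      · rw [Set.indicator_of_mem (by rw [mem_ball_zero_iff, hn]; exact h2),
          Set.indicator_of_mem (show p ∈ Ioo (0:ℝ) ρ ×ˢ Ioo (-Real.pi) Real.pi from
            ⟨⟨hp0, h2⟩, h1.2⟩), hs]
        rfl
      · rw [Set.indicator_of_notMem (by rw [mem_ball_zero_iff, hn]; exact h2),
          Set.indicator_of_notMem (fun hp => h2 hp.1.2), smul_zero]
    · rw [Set.indicator_of_notMem h1, Set.indicator_of_notMem]
      exact fun hp => h1 ⟨hp.1.1, hp.2⟩
  rw [e2]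
  have hFint : IntegrableOn (fun p : ℝ × ℝ => p.1 • h (circleMap w p.1 p.2))
      (Ioo (0:ℝ) ρ ×ˢ Ioo (-Real.pi) Real.pi) := by
    have hc : ContinuousOn (fun p : ℝ × ℝ => p.1 • h (circleMap w p.1 p.2))
        (Icc (0:ℝ) ρ ×ˢ Icc (-Real.pi) Real.pi) := by
      refine continuousOn_fst.smul (hh.continuousOn.comp ?_ ?_)
      · unfold circleMap; fun_prop
      · intro p hp
        simp [circleMap, abs_of_nonneg hp.1.1]
        exact hp.1.2
    exact (hc.integrableOn_compact (isCompact_Icc.prod isCompact_Icc)).mono_set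
      (Set.prod_mono Ioo_subset_Icc_self Ioo_subset_Icc_self)
  rw [Measure.volume_eq_prod] at hFint ⊢
  rw [setIntegral_prod _ hFint]
  have e3 : ∀ x ∈ Ioo (0:ℝ) ρ, ∫ t in Ioo (-Real.pi) Real.pi, x • h (circleMap w x t)
      = (2 * Real.pi * x) • h w := by
    intro x hx
    have hd : DiffContOnCl ℂ h (ball w |x|) := by
      rw [abs_of_pos hx.1]
      refine (hh.mono ?_).diffContOnCl
      rw [closure_ball _ hx.1.ne']
      exact closedBall_subset_closedBall hx.2.le
    have hav := hd.circleAverage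
    rw [Real.circleAverage_def] at hav
    have hper : ∫ t in Ioo (-Real.pi) Real.pi, h (circleMap w x t) =
        ∫ t in (0:ℝ)..(2 * Real.pi), h (circleMap w x t) := by
      rw [← integral_Ioc_eq_integral_Ioo, ← intervalIntegral.integral_of_le (by linarith [Real.pi_pos])]
      have hP : Function.Periodic (fun t => h (circleMap w x t)) (2 * Real.pi) :=
        fun t => by simp only [periodic_circleMap w x t]
      have := hP.intervalIntegral_add_eq (-Real.pi) 0
      rw [zero_add] at this
      rw [← this]
      congr 1; ring
    rw [integral_smul, hper, ← hav]
    rw [smul_smul]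
    congr 1
    field_simp
  rw [setIntegral_congr_fun measurableSet_Ioo e3, integral_smul_const]
  congr 1
  rw [← integral_Ioc_eq_integral_Ioo, ← intervalIntegral.integral_of_le hρ.le]
  rw [intervalIntegral.integral_const_mul, integral_id]
  ring

variable {K : Type*} [NormedAddCommGroup K] [InnerProductSpace ℂ K] [CompleteSpace K]

/-- Vector mean value, tested against a vector. -/
lemma area_mean_inner {f : ℂ → K} {w : ℂ} {ρ : ℝ} (hρ : 0 < ρ)
    (hf : DifferentiableOn ℂ f (closedBall w ρ)) (e : K) :
    (Real.pi * ρ ^ 2) * (RCLike.re (⟪f w, e⟫_ℂ)) ≤ ∫ u in ball w ρ, ‖⟪f u, e⟫_ℂ‖ := by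
  have hd : DifferentiableOn ℂ (fun u => ⟪e, f u⟫_ℂ) (closedBall w ρ) :=
    (innerSL ℂ e).differentiable.comp_differentiableOn hf
  have h1 := area_mean_value hρ hd
  have h2 : ‖(Real.pi * ρ ^ 2 : ℝ) • ⟪e, f w⟫_ℂ‖ ≤ ∫ u in ball w ρ, ‖⟪e, f u⟫_ℂ‖ := by
    rw [← h1]; exact norm_integral_le_integral_norm _
  have h3 : ∀ u, ‖⟪f u, e⟫_ℂ‖ = ‖⟪e, f u⟫_ℂ‖ := fun u => norm_inner_symm _ _
  simp only [h3]
  refine le_trans ?_ h2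
  rw [norm_smul, Real.norm_of_nonneg (by positivity), ← h3]
  gcongr
  exact RCLike.re_le_norm _

lemma sub_mean {f : ℂ → K} {w : ℂ} {ρ : ℝ} (hρ : 0 < ρ)
    (hf : DifferentiableOn ℂ f (closedBall w ρ)) :
    (Real.pi * ρ ^ 2) * ‖f w‖ ^ 2 ≤ ∫ u in ball w ρ, ‖f u‖ ^ 2 := by
  have h1 := area_mean_inner hρ hf (f w)
  rw [inner_self_eq_norm_sq] at h1
  have hi : IntegrableOn (fun u => ‖f u‖ ^ 2) (ball w ρ) :=
    ((hf.continuousOn.norm.pow 2).integrableOn_compact (isCompact_closedBall _ _)).mono_set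
      ball_subset_closedBall
  have hi' : IntegrableOn (fun u => ‖⟪f u, f w⟫_ℂ‖) (ball w ρ) := by
    have : ContinuousOn (fun u => ‖⟪f u, f w⟫_ℂ‖) (closedBall w ρ) :=
      (hf.continuousOn.inner (𝕜 := ℂ) continuousOn_const).norm
    exact (this.integrableOn_compact (isCompact_closedBall _ _)).mono_set
      ball_subset_closedBall
  have hvol : volume.real (ball w ρ) = Real.pi * ρ ^ 2 := by
    rw [Measure.real, Complex.volume_ball]
    simp [ENNReal.toReal_ofReal hρ.le, NNReal.coe_real_pi, mul_comm]
  have h2 : ∫ u in ball w ρ, ‖⟪f u, f w⟫_ℂ‖ ≤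
      ∫ u in ball w ρ, (2⁻¹ * ‖f u‖ ^ 2 + 2⁻¹ * ‖f w‖ ^ 2) := by
    refine integral_mono hi' ((hi.const_mul _).add (integrableOn_const (by
      rw [Complex.volume_ball]; finiteness))) fun u => ?_
    have := norm_inner_le_norm (𝕜 := ℂ) (f u) (f w)
    simp only
    nlinarith [sq_nonneg (‖f u‖ - ‖f w‖)]
  rw [integral_add (hi.const_mul _) (integrableOn_const (by
      rw [Complex.volume_ball]; finiteness)), integral_const_mul, setIntegral_const, hvol] at h2
  simp only [smul_eq_mul] at h2
  linarith

/-- Cauchy estimate in area form. -/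
lemma deriv_area_est (n : ℕ) {g : ℂ → K} {z : ℂ} {R : ℝ} (hR : 0 < R)
    (hg : DifferentiableOn ℂ g (closedBall z R)) :
    ‖iteratedDeriv n g z‖ ^ 2 ≤
      ((n.factorial : ℝ) ^ 2 * 2 ^ (2 * n) * 4) * (R ^ (2 * n + 2))⁻¹ * ∫ u in ball z R, ‖g u‖ ^ 2 := by
  set J := ∫ u in ball z R, ‖g u‖ ^ 2 with hJ
  have hJ0 : 0 ≤ J := integral_nonneg fun _ => by positivity
  have hi : IntegrableOn (fun u => ‖g u‖ ^ 2) (ball z R) :=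
    ((hg.continuousOn.norm.pow 2).integrableOn_compact (isCompact_closedBall _ _)).mono_set
      ball_subset_closedBall
  have hsup : ∀ w ∈ sphere z (R / 2), ‖g w‖ ≤ Real.sqrt (4 / R ^ 2 * J) := by
    intro w hw
    apply Real.le_sqrt_of_sq_le
    have hwz : dist w z = R / 2 := hw
    have hsub : closedBall w (R / 2) ⊆ closedBall z R :=
      closedBall_subset_closedBall' (by rw [hwz]; linarith)
    have hsub' : ball w (R / 2) ⊆ ball z R :=
      ball_subset_ball' (by rw [hwz]; linarith)
    have h1 := sub_mean (half_pos hR) (hg.mono hsub)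
    have h2 : ∫ u in ball w (R / 2), ‖g u‖ ^ 2 ≤ J :=
      setIntegral_mono_set hi (by filter_upwards with u; positivity)
        (Filter.Eventually.of_forall hsub')
    have h3 : (R / 2) ^ 2 * ‖g w‖ ^ 2 ≤ J := by
      have : (R / 2) ^ 2 * ‖g w‖ ^ 2 ≤ Real.pi * (R / 2) ^ 2 * ‖g w‖ ^ 2 := by
        have : (1:ℝ) ≤ Real.pi := by linarith [Real.pi_gt_three]
        nlinarith [show 0 ≤ (R / 2) ^ 2 * ‖g w‖ ^ 2 by positivity]
      linarith
    calc ‖g w‖ ^ 2 = 4 / R ^ 2 * ((R / 2) ^ 2 * ‖g w‖ ^ 2) := by field_simp; ring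
      _ ≤ _ := by gcongr
  have hdc : DiffContOnCl ℂ g (ball z (R / 2)) := by
    refine (hg.mono ?_).diffContOnCl
    rw [closure_ball _ (half_pos hR).ne']
    exact closedBall_subset_closedBall (by linarith)
  have h := Complex.norm_iteratedDeriv_le_of_forall_mem_sphere_norm_le n (half_pos hR) hdc hsup
  calc ‖iteratedDeriv n g z‖ ^ 2 ≤ (n.factorial * Real.sqrt (4 / R ^ 2 * J) / (R / 2) ^ n) ^ 2 := by
        gcongr
    _ = _ := by
        rw [div_pow, mul_pow, Real.sq_sqrt (by positivity)]
        rw [div_pow, div_pow, ← pow_mul, ← pow_mul]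
        field_simp
        ring

lemma iteratedDeriv_clm_comp (T : K →L[ℂ] K) {U : Set ℂ} (hU : IsOpen U) {f : ℂ → K}
    (hf : DifferentiableOn ℂ f U) (n : ℕ) :
    ∀ z ∈ U, iteratedDeriv n (fun u => T (f u)) z = T (iteratedDeriv n f z) := by
  induction n with
  | zero => intro z _; simp
  | succ k ih =>
    intro z hz
    rw [iteratedDeriv_succ, iteratedDeriv_succ]
    have he : iteratedDeriv k (fun u => T (f u)) =ᶠ[nhds z] fun u => T (iteratedDeriv k f u) := by
      filter_upwards [hU.mem_nhds hz] with u hu using ih u hu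
    rw [he.deriv_eq]
    have ha : AnalyticAt ℂ f z := hf.analyticAt (hU.mem_nhds hz)
    have hd : DifferentiableAt ℂ (iteratedDeriv k f) z := by
      rw [iteratedDeriv_eq_iterate]
      exact (ha.iterated_deriv k).differentiableAt
    exact (T.hasFDerivAt.comp_hasDerivAt z hd.hasDerivAt).deriv

end MeanValue

section Geometry

lemma lint_radial (η : ℝ) (hη : -1 < η) {h : ℝ} (hh : 0 < h) :
    ∫⁻ x in Ioo (1 - h) 1, ENNReal.ofReal ((η + 1) * (1 - x) ^ η) = ENNReal.ofReal (h ^ (η + 1)) := by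
  have hii : IntervalIntegrable (fun x : ℝ => (η + 1) * (1 - x) ^ η) volume (1 - h) 1 := by
    have h0 : IntervalIntegrable (fun x : ℝ => x ^ η) volume h 0 :=
      intervalIntegral.intervalIntegrable_rpow' hη
    have := (h0.comp_sub_left 1).const_mul (η + 1)
    simpa using this
  have hi : IntegrableOn (fun x : ℝ => (η + 1) * (1 - x) ^ η) (Ioo (1 - h) 1) := by
    have := (intervalIntegrable_iff_integrableOn_Ioo_of_le (by linarith)).1 hii
    exact this
  rw [← ofReal_integral_eq_lintegral_ofReal hi]
  · congr 1
    rw [← integral_Ioc_eq_integral_Ioo, ← intervalIntegral.integral_of_le (by linarith)]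
    rw [intervalIntegral.integral_const_mul,
      intervalIntegral.integral_comp_sub_left (fun x : ℝ => x ^ η) 1]
    simp only [sub_self, sub_sub_cancel]
    rw [integral_rpow (Or.inl hη), Real.zero_rpow (by linarith)]
    have : η + 1 ≠ 0 := by linarith
    field_simp
    ring
  · refine (ae_restrict_iff' measurableSet_Ioo).2 (Filter.Eventually.of_forall fun x hx => ?_)
    have h1 : 0 ≤ (1 - x) ^ η := Real.rpow_nonneg (by linarith [hx.2]) _
    have h2 : 0 ≤ η + 1 := by linarith
    exact mul_nonneg h2 h1

lemma areaM_le_volume : areaM ≤ (volume : Measure ℂ) := by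
  intro s
  rw [areaM, Measure.smul_apply, smul_eq_mul]
  have h1 : (ENNReal.ofReal Real.pi)⁻¹ ≤ 1 := by
    rw [ENNReal.inv_le_one, ENNReal.one_le_ofReal]
    linarith [Real.pi_gt_three]
  calc _ ≤ 1 * volume s := mul_le_mul' h1 (Measure.restrict_le_self s)
    _ = _ := one_mul _

lemma carleson_subset {h θ : ℝ} (_hh : 0 < h) (hh1 : h < 1) (hθ : 0 ≤ θ) (hθ' : θ < 2 * Real.pi)
    {z : ℂ} (hz : z ∈ carlesonSquare h θ) :
    1 - h < ‖z‖ ∧ ‖z‖ < 1 ∧ arg z ∈ Ioo (θ - Real.pi * h) (θ + Real.pi * h) ∪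
      Ioo (θ - 2 * Real.pi - Real.pi * h) (θ - 2 * Real.pi + Real.pi * h) := by
  obtain ⟨ρ, t, h1, h2, h3, rfl⟩ := hz
  have hρ : 0 < ρ := by linarith
  have hn : ‖(ρ:ℂ) * Complex.exp (t * I)‖ = ρ := by
    rw [norm_mul, Complex.norm_exp_ofReal_mul_I, mul_one, Complex.norm_real,
      Real.norm_of_nonneg hρ.le]
  rw [hn]
  refine ⟨h1, h2, ?_⟩
  set a := arg ((ρ:ℂ) * Complex.exp (t * I)) with ha
  have hcoe : ((a : ℝ) : Real.Angle) = (t : Real.Angle) := by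
    have := Complex.arg_mul_cos_add_sin_mul_I_coe_angle hρ (t : Real.Angle)
    rw [Real.Angle.cos_coe, Real.Angle.sin_coe] at this
    rw [ha, Complex.exp_mul_I, ← Complex.ofReal_cos, ← Complex.ofReal_sin]
    exact this
  obtain ⟨k, hk⟩ := Real.Angle.angle_eq_iff_two_pi_dvd_sub.1 hcoe
  have ha1 := Complex.neg_pi_lt_arg ((ρ:ℂ) * Complex.exp (t * I))
  have ha2 := Complex.arg_le_pi ((ρ:ℂ) * Complex.exp (t * I))
  rw [← ha] at ha1 ha2
  rw [abs_lt] at h3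
  have hpi := Real.pi_pos
  have hph : Real.pi * h < Real.pi := by nlinarith
  have hk1 : (k:ℝ) < 1 := by
    by_contra hc
    push Not at hc
    nlinarith
  have hk2 : (-2:ℝ) < k := by
    by_contra hc
    push Not at hc
    nlinarith
  have hk1' : k < 1 := by exact_mod_cast hk1
  have hk2' : -2 < k := by exact_mod_cast hk2
  have : k = 0 ∨ k = -1 := by omega
  rcases this with rfl | rfl
  · left
    simp at hk
    constructor <;> linarith
  · right
    push_cast at hk
    constructor <;> linarith

lemma carleson_measure (η : ℝ) (hη : -1 < η) {h θ : ℝ} (hh : 0 < h) (hh1 : h < 1)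
    (hθ : 0 ≤ θ) (hθ' : θ < 2 * Real.pi) :
    measAeta η (carlesonSquare h θ) ≤ ENNReal.ofReal (4 * Real.pi * h ^ (2 + η)) := by
  set A : Set ℝ := Ioo (θ - Real.pi * h) (θ + Real.pi * h) ∪
      Ioo (θ - 2 * Real.pi - Real.pi * h) (θ - 2 * Real.pi + Real.pi * h) with hA
  have hAm : MeasurableSet A := measurableSet_Ioo.union measurableSet_Ioo
  have hpi := Real.pi_pos
  have hAv : volume A ≤ ENNReal.ofReal (4 * Real.pi * h) := by
    refine (measure_union_le _ _).trans ?_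
    rw [Real.volume_Ioo, Real.volume_Ioo, ← ENNReal.ofReal_add (by nlinarith) (by nlinarith)]
    apply ENNReal.ofReal_le_ofReal
    linarith
  set T : Set ℂ := {z | 1 - h < ‖z‖ ∧ ‖z‖ < 1 ∧ arg z ∈ A} with hT
  have hTm : MeasurableSet T := by
    refine (measurableSet_lt measurable_const measurable_norm).inter
      ((measurableSet_lt measurable_norm measurable_const).inter ?_)
    exact Complex.measurable_arg hAm
  have hsub : carlesonSquare h θ ⊆ T := fun z hz => carleson_subset hh hh1 hθ hθ' hz
  set φ : ℝ → ℝ≥0∞ := fun x => ENNReal.ofReal ((η + 1) * (1 - x) ^ η) with hφ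
  have hφm : Measurable φ := by
    apply ENNReal.measurable_ofReal.comp
    exact ((measurable_const.sub measurable_id).pow_const η).const_mul _
  calc measAeta η (carlesonSquare h θ) ≤ measAeta η T := measure_mono hsub
    _ = ∫⁻ z in T, φ ‖z‖ ∂areaM := by rw [measAeta, withDensity_apply _ hTm]
    _ ≤ ∫⁻ z in T, φ ‖z‖ := lintegral_mono' (Measure.restrict_mono le_rfl areaM_le_volume) le_rfl
    _ = ∫⁻ z, T.indicator (fun z => φ ‖z‖) z := (lintegral_indicator hTm _).symm
    _ = ∫⁻ p in polarCoord.target, ENNReal.ofReal p.1 •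
          T.indicator (fun z => φ ‖z‖) (Complex.polarCoord.symm p) :=
        (Complex.lintegral_comp_polarCoord_symm _).symm
    _ ≤ ∫⁻ p in polarCoord.target, (Ioo (1 - h) 1).indicator φ p.1 * A.indicator 1 p.2 := by
        refine setLIntegral_mono' (by
          rw [polarCoord_target]; exact measurableSet_Ioi.prod measurableSet_Ioo) fun p hp => ?_
        rw [polarCoord_target] at hp
        have hp0 : 0 < p.1 := hp.1
        have hn : ‖Complex.polarCoord.symm p‖ = p.1 := by
          rw [Complex.norm_polarCoord_symm, abs_of_pos hp0]
        have harg : arg (Complex.polarCoord.symm p) = p.2 := by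
          have hs : Complex.polarCoord.symm p
              = p.1 * (Complex.cos p.2 + Complex.sin p.2 * I) := by
            rw [Complex.polarCoord_symm_apply, Complex.ofReal_cos, Complex.ofReal_sin]
          rw [hs]
          exact Complex.arg_mul_cos_add_sin_mul_I hp0 ⟨hp.2.1, hp.2.2.le⟩
        by_cases hz : Complex.polarCoord.symm p ∈ T
        · rw [Set.indicator_of_mem hz]
          obtain ⟨h1, h2, h3⟩ := hz
          rw [hn] at h1 h2
          rw [harg] at h3
          rw [Set.indicator_of_mem (show p.1 ∈ Ioo (1 - h) 1 from ⟨h1, h2⟩),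
            Set.indicator_of_mem h3, hn]
          simp only [smul_eq_mul, Pi.one_apply, mul_one]
          calc ENNReal.ofReal p.1 * φ p.1 ≤ 1 * φ p.1 := by
                gcongr
                exact ENNReal.ofReal_le_one.2 h2.le
            _ = _ := one_mul _
        · rw [Set.indicator_of_notMem hz]
          simp
    _ ≤ ∫⁻ p, (Ioo (1 - h) 1).indicator φ p.1 * A.indicator 1 p.2 ∂(volume.prod volume) :=
        setLIntegral_le_lintegral _ _
    _ = (∫⁻ x, (Ioo (1 - h) 1).indicator φ x) * ∫⁻ y, A.indicator 1 y :=
        lintegral_prod_mul (hφm.indicator measurableSet_Ioo).aemeasurable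
          (measurable_one.indicator hAm).aemeasurable
    _ = ENNReal.ofReal (h ^ (η + 1)) * volume A := by
        rw [lintegral_indicator measurableSet_Ioo, lint_radial η hη hh, lintegral_indicator_one hAm]
    _ ≤ ENNReal.ofReal (h ^ (η + 1)) * ENNReal.ofReal (4 * Real.pi * h) := by gcongr
    _ = _ := by
        rw [← ENNReal.ofReal_mul (by positivity)]
        congr 1
        have : h ^ (2 + η) = h ^ (η + 1) * h := by
          rw [← Real.rpow_add_one hh.ne']
          congr 1; ring
        rw [this]
        ring

lemma disc_subset_carleson {ζ : ℂ} (h1 : 3 / 4 ≤ ‖ζ‖) (h2 : ‖ζ‖ < 1) {r : ℝ} (hr1 : r < 1) :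
    ∃ θ : ℝ, 0 ≤ θ ∧ θ < 2 * Real.pi ∧ discAt ζ r ⊆ carlesonSquare (2 * (1 - ‖ζ‖)) θ := by
  have hpi := Real.pi_pos
  obtain ⟨θ, hθ0, hθ1, hθ⟩ : ∃ θ : ℝ, 0 ≤ θ ∧ θ < 2 * Real.pi ∧
      ζ = ‖ζ‖ * Complex.exp (θ * I) := by
    have ha1 := Complex.neg_pi_lt_arg ζ
    have ha2 := Complex.arg_le_pi ζ
    by_cases hs : 0 ≤ arg ζ
    · exact ⟨arg ζ, hs, by linarith, (Complex.norm_mul_exp_arg_mul_I ζ).symm⟩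
    · refine ⟨arg ζ + 2 * Real.pi, by linarith, by linarith, ?_⟩
      push_cast
      rw [add_mul, Complex.exp_periodic]
      exact (Complex.norm_mul_exp_arg_mul_I ζ).symm
  refine ⟨θ, hθ0, hθ1, fun w hw => ?_⟩
  obtain ⟨hw1, hw2⟩ := hw
  have hδ : 0 < 1 - ‖ζ‖ := by linarith
  have hw3 : ‖w - ζ‖ < 1 - ‖ζ‖ := by nlinarith
  have hζ0 : ζ ≠ 0 := by
    intro h; rw [h, norm_zero] at h1; linarith
  have hu : w / ζ = 1 + (w - ζ) / ζ := by field_simp; ring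
  have hun : ‖(w - ζ) / ζ‖ < 4 / 3 * (1 - ‖ζ‖) := by
    rw [norm_div, div_lt_iff₀ (by linarith)]
    nlinarith
  have hlog : ‖Complex.log (w / ζ)‖ ≤ 3 / 2 * ‖(w - ζ) / ζ‖ := by
    rw [hu]
    exact Complex.norm_log_one_add_half_le_self (by linarith)
  have harg : |arg (w / ζ)| < 2 * (1 - ‖ζ‖) := by
    have := Complex.abs_im_le_norm (Complex.log (w / ζ))
    rw [Complex.log_im] at this
    linarith
  refine ⟨‖w‖, θ + arg (w / ζ), ?_, hw1, ?_, ?_⟩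
  · have := norm_sub_norm_le ζ w
    rw [norm_sub_rev] at this
    linarith
  · rw [add_sub_cancel_left]
    refine harg.trans ?_
    nlinarith [Real.pi_gt_three]
  · have e1 : w = ζ * (w / ζ) := by field_simp
    have e2 := Complex.norm_mul_exp_arg_mul_I (w / ζ)
    have e3 : (‖w‖ : ℂ) = ‖ζ‖ * ‖w / ζ‖ := by
      rw [norm_div]
      push_cast
      have : (‖ζ‖ : ℂ) ≠ 0 := by exact_mod_cast (norm_pos_iff.2 hζ0).ne'
      field_simp
    calc w = ζ * (w / ζ) := e1
      _ = (‖ζ‖ * Complex.exp (θ * I)) * (‖w / ζ‖ * Complex.exp (arg (w / ζ) * I)) := by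
          rw [← hθ, e2]
      _ = _ := by
          push_cast
          rw [e3, add_mul, Complex.exp_add]
          ring

end Geometry

section Local

set_option linter.unusedSectionVars false

variable {K : Type*} [NormedAddCommGroup K] [InnerProductSpace ℂ K] [CompleteSpace K]

lemma ae_measAeta {η : ℝ} {p : ℂ → Prop} (h : ∀ᵐ z ∂areaM, p z) : ∀ᵐ z ∂(measAeta η), p z :=
  (withDensity_absolutelyContinuous areaM _).ae_le h

lemma discAt_subset_ball (ζ : ℂ) (r : ℝ) : discAt ζ r ⊆ ball (0:ℂ) 1 := fun z hz => by
  simpa using hz.1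

lemma local_b2 (η : ℝ) (hη : -1 < η) {r : ℝ} (hr1 : r < 1) {W Winv : ℂ → K →L[ℂ] K}
    (hW : IsB2Weight η W Winv) :
    ∃ k : ℝ, 0 < k ∧ ∀ ζ : ℂ, ‖ζ‖ < 1 → ∃ S : Set ℂ, ∃ P Q : K →L[ℂ] K,
      discAt ζ r ⊆ S ∧ IsWeakOpIntegral (measAeta η) W S P ∧
      IsWeakOpIntegral (measAeta η) Winv S Q ∧
      ∀ y, Q.reApplyInnerSelf (P y) ≤ k * ((1 - ‖ζ‖) ^ (2 + η)) ^ 2 * P.reApplyInnerSelf y := by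
  obtain ⟨hae, ⟨TW, hTW, -⟩, ⟨TWi, hTWi⟩, c, hc⟩ := hW
  have hWp : ∀ᵐ z ∂(measAeta η), (W z).IsPositive :=
    ae_measAeta (by filter_upwards [hae] with z hz using hz.1)
  have hWip : ∀ᵐ z ∂(measAeta η), (Winv z).IsPositive :=
    ae_measAeta (by filter_upwards [hae] with z hz using inv_isPositive hz.1 hz.2.1)
  have hη2 : 0 < 2 + η := by linarith
  set q : ℝ := ((1/4 : ℝ) ^ (2 + η)) ^ 2 with hq
  have hq0 : 0 < q := by positivity
  set k1 : ℝ := ‖TWi‖ * ‖TW‖ / q with hk1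
  set k2 : ℝ := c ^ 2 * (4 * Real.pi * 2 ^ (2 + η)) ^ 2 with hk2
  have hk10 : 0 ≤ k1 := by positivity
  have hk20 : 0 ≤ k2 := by positivity
  refine ⟨k1 + k2 + 1, by positivity, fun ζ hζ => ?_⟩
  have hδ : 0 < 1 - ‖ζ‖ := by linarith
  by_cases hbig : 3 / 4 ≤ ‖ζ‖
  · obtain ⟨θ, hθ0, hθ1, hsub⟩ := disc_subset_carleson hbig hζ hr1
    set h := 2 * (1 - ‖ζ‖) with hh
    have hh0 : 0 < h := by positivity
    have hh1 : h < 1 := by linarith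
    obtain ⟨P, hP⟩ := weak_exists_of_ball (measAeta_restrict_ball η) hWp hTW (carlesonSquare h θ)
    obtain ⟨Q, hQ⟩ := weak_exists_of_ball (measAeta_restrict_ball η) hWip hTWi (carlesonSquare h θ)
    refine ⟨_, P, Q, hsub, hP, hQ, fun y => ?_⟩
    have hPp := weak_pos hWp hP
    have hQp := weak_pos hWip hQ
    have hm := carleson_measure η hη hh0 hh1 hθ0 hθ1
    set m := (measAeta η (carlesonSquare h θ)).toReal with hmdef
    have hm' : m ≤ 4 * Real.pi * h ^ (2 + η) := by
      refine ENNReal.toReal_le_of_le_ofReal (by positivity) hm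
    have hPy : 0 ≤ P.reApplyInnerSelf y := hPp.2 y
    rcases (ENNReal.toReal_nonneg (a := measAeta η (carlesonSquare h θ))).eq_or_lt with h0 | hpos
    · have hfin : measAeta η (carlesonSquare h θ) ≠ ⊤ := ne_top_of_le_ne_top ENNReal.ofReal_ne_top hm
      have hz : measAeta η (carlesonSquare h θ) = 0 := by
        rcases (ENNReal.toReal_eq_zero_iff _).1 h0.symm with h | h
        · exact h
        · exact absurd h hfin
      have : Q.reApplyInnerSelf (P y) = 0 := by
        rw [weak_reApply hQ, Measure.restrict_eq_zero.2 hz, integral_zero_measure]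
      rw [this]
      positivity
    · have hmpos : 0 < m := hpos
      have hPm : (m⁻¹ • P).IsPositive := by
        refine ⟨?_, fun x => ?_⟩
        · intro x y
          have := hPp.1 x y
          simp only [ContinuousLinearMap.coe_coe] at this
          simp only [ContinuousLinearMap.coe_coe, smul_apply]
          rw [inner_smul_left_eq_smul, inner_smul_right_eq_smul, this]
        · rw [ContinuousLinearMap.reApplyInnerSelf_apply, smul_apply, inner_smul_left_eq_smul]
          have := hPp.2 x
          rw [ContinuousLinearMap.reApplyInnerSelf_apply] at this
          rw [RCLike.smul_re]
          positivity
      have hQm : (m⁻¹ • Q).IsPositive := by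
        refine ⟨?_, fun x => ?_⟩
        · intro x y
          have := hQp.1 x y
          simp only [ContinuousLinearMap.coe_coe] at this
          simp only [ContinuousLinearMap.coe_coe, smul_apply]
          rw [inner_smul_left_eq_smul, inner_smul_right_eq_smul, this]
        · rw [ContinuousLinearMap.reApplyInnerSelf_apply, smul_apply, inner_smul_left_eq_smul]
          have := hQp.2 x
          rw [ContinuousLinearMap.reApplyInnerSelf_apply] at this
          rw [RCLike.smul_re]
          positivity
      obtain ⟨Ps, hPs, hPs2⟩ := exists_pos_sqrt _ hPm
      obtain ⟨Qs, hQs, hQs2⟩ := exists_pos_sqrt _ hQm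
      have hcc := hc h θ hh0 hh1 hθ0 hθ1 P Q Ps Qs hP hQ hPs hQs hPs2 hQs2
      have := b2_op hmpos hPs hQs hPs2 hQs2 hcc y
      refine this.trans (mul_le_mul_of_nonneg_right ?_ hPy)
      calc c ^ 2 * m ^ 2 ≤ c ^ 2 * (4 * Real.pi * h ^ (2 + η)) ^ 2 := by gcongr
        _ = k2 * ((1 - ‖ζ‖) ^ (2 + η)) ^ 2 := by
          rw [hh, Real.mul_rpow (by norm_num) hδ.le, hk2]; ring
        _ ≤ _ := by gcongr; linarith
  · push Not at hbig
    refine ⟨_, TW, TWi, discAt_subset_ball ζ r, hTW, hTWi, fun y => ?_⟩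
    have hPp := weak_pos hWp hTW
    have hPy : 0 ≤ TW.reApplyInnerSelf y := hPp.2 y
    have hqle : q ≤ ((1 - ‖ζ‖) ^ (2 + η)) ^ 2 := by
      rw [hq]
      gcongr
      linarith
    calc TWi.reApplyInnerSelf (TW y) ≤ ‖TWi‖ * ‖TW y‖ ^ 2 := reApply_le_norm _ _
      _ ≤ ‖TWi‖ * (‖TW‖ * TW.reApplyInnerSelf y) := by gcongr; exact norm_sq_le_of_pos hPp y
      _ = k1 * q * TW.reApplyInnerSelf y := by rw [hk1]; field_simp
      _ ≤ _ := by gcongr; linarith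

lemma rpow_lower (η : ℝ) {r : ℝ} (hr1 : r < 1) :
    ∃ κ : ℝ, 0 < κ ∧ ∀ x : ℝ, 1 - r ≤ x → x ≤ 2 → κ ≤ x ^ η := by
  have h1r : 0 < 1 - r := by linarith
  refine ⟨min ((1 - r) ^ η) (2 ^ η), by positivity, fun x hx1 hx2 => ?_⟩
  rcases le_or_gt 0 η with h | h
  · exact (min_le_left _ _).trans (Real.rpow_le_rpow h1r.le hx1 h)
  · exact (min_le_right _ _).trans (Real.rpow_le_rpow_of_nonpos (by linarith) hx2 h.le)

lemma discAt_eq {ζ : ℂ} (hζ : ‖ζ‖ < 1) {r : ℝ} (hr1 : r < 1) :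
    discAt ζ r = ball ζ (r * (1 - ‖ζ‖)) := by
  ext w
  simp only [discAt, mem_ofPred_eq, mem_ball, dist_eq_norm]
  refine ⟨fun h => h.2, fun h => ⟨?_, h⟩⟩
  have := norm_sub_norm_le w ζ
  nlinarith

lemma closedBall_sub {ζ : ℂ} (hζ : ‖ζ‖ < 1) {r : ℝ} (hr1 : r < 1) :
    closedBall ζ (r * (1 - ‖ζ‖)) ⊆ ball (0:ℂ) 1 := by
  intro w hw
  rw [mem_closedBall, dist_eq_norm] at hw
  rw [mem_ball_zero_iff]
  have := norm_sub_norm_le w ζ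
  nlinarith

lemma vol_le_measAeta (η : ℝ) (hη : -1 < η) {r : ℝ} (hr1 : r < 1) :
    ∃ κ : ℝ, 0 < κ ∧ ∀ ζ : ℂ, ‖ζ‖ < 1 → ∀ g : ℂ → ℝ≥0∞,
      ∫⁻ u in discAt ζ r, g u ≤
        ENNReal.ofReal (κ / (1 - ‖ζ‖) ^ η) * ∫⁻ u in discAt ζ r, g u ∂(measAeta η) := by
  obtain ⟨κ, hκ, hκ'⟩ := rpow_lower η hr1
  have hη1 : 0 < η + 1 := by linarith
  have hpi := Real.pi_pos
  refine ⟨Real.pi / ((η + 1) * κ), by positivity, fun ζ hζ g => ?_⟩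
  have hδ : 0 < 1 - ‖ζ‖ := by linarith
  have hDm : MeasurableSet (discAt ζ r) := by
    rw [discAt_eq hζ hr1]; exact measurableSet_ball
  set a : ℝ≥0∞ := ENNReal.ofReal (Real.pi / ((η + 1) * κ) / (1 - ‖ζ‖) ^ η) with ha
  have hle : volume.restrict (discAt ζ r) ≤ a • (measAeta η).restrict (discAt ζ r) := by
    rw [measAeta, restrict_withDensity hDm, areaM, Measure.restrict_smul,
      Measure.restrict_restrict hDm, Set.inter_eq_left.2 (discAt_subset_ball ζ r)]
    rw [withDensity_smul_measure, smul_smul, ← withDensity_smul _ (by fun_prop)]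
    have : volume.restrict (discAt ζ r) = (volume.restrict (discAt ζ r)).withDensity 1 :=
      withDensity_one.symm
    nth_rewrite 1 [this]
    apply withDensity_mono
    refine (ae_restrict_iff' hDm).2 (Filter.Eventually.of_forall fun u hu => ?_)
    simp only [Pi.one_apply, Pi.smul_apply, smul_eq_mul]
    have hu2 := hu.2
    have h1 : (1 - r) * (1 - ‖ζ‖) ≤ 1 - ‖u‖ := by
      have := norm_sub_norm_le u ζ
      linarith
    have h2 : 1 - ‖u‖ ≤ 2 * (1 - ‖ζ‖) := by
      have := norm_sub_norm_le ζ u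
      rw [norm_sub_rev] at this
      nlinarith
    have h3 := hκ' ((1 - ‖u‖) / (1 - ‖ζ‖)) ((le_div_iff₀ hδ).2 h1) ((div_le_iff₀ hδ).2 h2)
    have hu1 : 0 < 1 - ‖u‖ := by linarith [hu.1]
    rw [Real.div_rpow hu1.le hδ.le] at h3
    rw [ha, ← ENNReal.ofReal_inv_of_pos hpi, ← ENNReal.ofReal_mul (by positivity),
      ← ENNReal.ofReal_mul (by positivity), ENNReal.one_le_ofReal]
    have hd : 0 < (1 - ‖ζ‖) ^ η := by positivity
    calc (1:ℝ) = κ⁻¹ * κ := by field_simp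
      _ ≤ κ⁻¹ * ((1 - ‖u‖) ^ η / (1 - ‖ζ‖) ^ η) := by gcongr
      _ = _ := by field_simp
  calc ∫⁻ u in discAt ζ r, g u ≤ ∫⁻ u, g u ∂(a • (measAeta η).restrict (discAt ζ r)) :=
        lintegral_mono' hle le_rfl
    _ = _ := by rw [lintegral_smul_measure, smul_eq_mul]

lemma area_mean_inner_lint {f : ℂ → K} {w : ℂ} {ρ : ℝ} (hρ : 0 < ρ)
    (hf : DifferentiableOn ℂ f (closedBall w ρ)) (e : K) :
    ENNReal.ofReal ((Real.pi * ρ ^ 2) * (RCLike.re (⟪f w, e⟫_ℂ))) ≤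
      ∫⁻ u in ball w ρ, ENNReal.ofReal ‖⟪f u, e⟫_ℂ‖ := by
  have h1 := area_mean_inner hρ hf e
  have hi' : IntegrableOn (fun u => ⟪f u, e⟫_ℂ) (ball w ρ) := by
    have : ContinuousOn (fun u => ⟪f u, e⟫_ℂ) (closedBall w ρ) :=
      (hf.continuousOn.inner (𝕜 := ℂ) continuousOn_const)
    exact (this.integrableOn_compact (isCompact_closedBall _ _)).mono_set
      ball_subset_closedBall
  rw [← ofReal_integral_eq_lintegral_ofReal hi'.norm (by filter_upwards with u; positivity)]
  exact ENNReal.ofReal_le_ofReal h1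

/-- The averaging lemma, pointwise form. -/
lemma averaging (η : ℝ) (hη : -1 < η) {r : ℝ} (hr : 0 < r) (hr1 : r < 1) {W Winv : ℂ → K →L[ℂ] K}
    (hW : IsB2Weight η W Winv) :
    ∃ C : ℝ, 0 ≤ C ∧ ∀ f : ℂ → K, DifferentiableOn ℂ f (ball (0 : ℂ) 1) →
      Integrable (fun z => (W z).reApplyInnerSelf (f z)) (measAeta η) →
      ∀ ζ : ℂ, ‖ζ‖ < 1 → ∀ T : K →L[ℂ] K, IsWeakOpIntegral (measAeta η) W (discAt ζ r) T →
      T.reApplyInnerSelf (f ζ) ≤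
        C * ∫ z in discAt ζ r, (W z).reApplyInnerSelf (f z) ∂(measAeta η) := by
  obtain ⟨k, hk, hkS⟩ := local_b2 η hη hr1 hW
  obtain ⟨κ, hκ, hvol⟩ := vol_le_measAeta η hη hr1
  obtain ⟨hae, -, -, -⟩ := hW
  have hae' : ∀ᵐ z ∂(measAeta η), (W z).IsPositive ∧ W z ∘L Winv z = 1 ∧ Winv z ∘L W z = 1 :=
    ae_measAeta hae
  have hWp : ∀ᵐ z ∂(measAeta η), (W z).IsPositive := by
    filter_upwards [hae'] with z hz using hz.1
  have hWip : ∀ᵐ z ∂(measAeta η), (Winv z).IsPositive := by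
    filter_upwards [hae'] with z hz using inv_isPositive hz.1 hz.2.1
  have hpi := Real.pi_pos
  refine ⟨κ ^ 2 * k / (Real.pi * r ^ 2) ^ 2, by positivity, fun f hf hfi ζ hζ T hT => ?_⟩
  obtain ⟨S, P, Q, hDS, hP, hQ, hPQ⟩ := hkS ζ hζ
  set δ := 1 - ‖ζ‖ with hδdef
  have hδ : 0 < δ := by rw [hδdef]; linarith
  set v := f ζ with hv
  set e := P v with he
  set D := discAt ζ r with hD
  set J := ∫ z in D, (W z).reApplyInnerSelf (f z) ∂(measAeta η) with hJ
  have hPp := weak_pos hWp hP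
  have hQp := weak_pos hWip hQ
  have hrest : (measAeta η).restrict D ≤ (measAeta η).restrict S := Measure.restrict_mono hDS le_rfl
  have hTP : T.reApplyInnerSelf v ≤ P.reApplyInnerSelf v := by
    rw [weak_reApply hT, weak_reApply hP]
    refine integral_mono_measure hrest ?_ (reApply_integrable (fun x y => (hP x y).1) v)
    filter_upwards [ae_restrict_of_ae hWp] with z hz using hz.2 v
  refine hTP.trans ?_
  set a := P.reApplyInnerSelf v with ha
  have ha0 : 0 ≤ a := hPp.2 v
  have haeq : RCLike.re (⟪v, e⟫_ℂ) = a := by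
    rw [ha, ContinuousLinearMap.reApplyInnerSelf_apply, he, hPp.inner_left_eq_inner_right]
  -- the integral of the inverse weight
  have hiD : Integrable (fun z => (Winv z).reApplyInnerSelf e) ((measAeta η).restrict D) :=
    (reApply_integrable (fun x y => (hQ x y).1) e).mono_measure hrest
  have hQD : ∫ z in D, (Winv z).reApplyInnerSelf e ∂(measAeta η) ≤ k * (δ ^ (2 + η)) ^ 2 * a := by
    refine le_trans ?_ (hPQ v)
    rw [weak_reApply hQ]
    refine integral_mono_measure hrest ?_ (reApply_integrable (fun x y => (hQ x y).1) e)
    filter_upwards [ae_restrict_of_ae hWip] with z hz using hz.2 e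
  have hfD : Integrable (fun z => (W z).reApplyInnerSelf (f z)) ((measAeta η).restrict D) :=
    hfi.mono_measure Measure.restrict_le_self
  set b := δ ^ η with hb
  have hb0 : 0 < b := by positivity
  have hb2 : δ ^ (2 + η) = δ ^ 2 * b := by
    rw [Real.rpow_add hδ, hb]; norm_num
  set t : ℝ := κ * k * (δ ^ 2 * b) / (Real.pi * r ^ 2) with ht
  have ht0 : 0 < t := by positivity
  have hrδ : 0 < r * δ := by positivity
  have hmean := area_mean_inner_lint hrδ (hf.mono (closedBall_sub hζ hr1)) e
  rw [← discAt_eq hζ hr1, ← hv, haeq] at hmean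
  have hstep : ENNReal.ofReal (Real.pi * (r * δ) ^ 2 * a) ≤
      ENNReal.ofReal (κ / b * ∫ z in D, (2⁻¹ * (t * (W z).reApplyInnerSelf (f z) +
        t⁻¹ * (Winv z).reApplyInnerSelf e)) ∂(measAeta η)) := by
    refine hmean.trans ((hvol ζ hζ _).trans ?_)
    rw [ENNReal.ofReal_mul (by positivity)]
    gcongr
    have hFint : Integrable (fun z => 2⁻¹ * (t * (W z).reApplyInnerSelf (f z) +
        t⁻¹ * (Winv z).reApplyInnerSelf e)) ((measAeta η).restrict D) :=
      ((hfD.const_mul t).add (hiD.const_mul t⁻¹)).const_mul 2⁻¹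
    rw [ofReal_integral_eq_lintegral_ofReal hFint]
    · refine lintegral_mono_ae ?_
      filter_upwards [ae_restrict_of_ae hae'] with z hz
      apply ENNReal.ofReal_le_ofReal
      have := pairing_amgm hz.1 hz.2.1 (f z) e ht0
      linarith
    · filter_upwards [ae_restrict_of_ae hae'] with z hz
      have h1 := hz.1.2 (f z)
      have h2 := (inv_isPositive hz.1 hz.2.1).2 e
      simp only [Pi.zero_apply]
      positivity
  have hJ0 : 0 ≤ J := by
    apply integral_nonneg_of_ae
    filter_upwards [ae_restrict_of_ae hWp] with z hz using hz.2 _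
  rw [integral_const_mul, integral_add (hfD.const_mul t) (hiD.const_mul t⁻¹), integral_const_mul,
    integral_const_mul] at hstep
  have hI0 : 0 ≤ ∫ z in D, (Winv z).reApplyInnerSelf e ∂(measAeta η) := by
    apply integral_nonneg_of_ae
    filter_upwards [ae_restrict_of_ae hWip] with z hz using hz.2 _
  rw [ENNReal.ofReal_le_ofReal_iff (by positivity)] at hstep
  have hfin : Real.pi * (r * δ) ^ 2 * a ≤
      κ / b * (2⁻¹ * (t * J + t⁻¹ * (k * (δ ^ 2 * b) ^ 2 * a))) := by
    refine hstep.trans ?_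
    rw [← hb2]
    gcongr
  have e1 : κ / b * (2⁻¹ * (t * J + t⁻¹ * (k * (δ ^ 2 * b) ^ 2 * a))) =
      2⁻¹ * (κ ^ 2 * k * δ ^ 2 / (Real.pi * r ^ 2) * J) + 2⁻¹ * (Real.pi * r ^ 2 * δ ^ 2 * a) := by
    rw [ht]; field_simp
  rw [e1] at hfin
  have e2 : Real.pi * r ^ 2 * δ ^ 2 * a ≤ κ ^ 2 * k * δ ^ 2 / (Real.pi * r ^ 2) * J := by
    have : Real.pi * (r * δ) ^ 2 * a = Real.pi * r ^ 2 * δ ^ 2 * a := by ring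
    linarith
  have e3 : κ ^ 2 * k / (Real.pi * r ^ 2) ^ 2 * J = 
      (Real.pi * r ^ 2 * δ ^ 2)⁻¹ * (κ ^ 2 * k * δ ^ 2 / (Real.pi * r ^ 2) * J) := by
    field_simp
  rw [e3, le_inv_mul_iff₀ (by positivity)]
  exact e2

end Local

section Final

set_option linter.unusedSectionVars false

variable {K : Type*} [NormedAddCommGroup K] [InnerProductSpace ℂ K] [CompleteSpace K]

instance : SFinite areaM := by
  unfold areaM; infer_instance

instance (η : ℝ) : SFinite (measAeta η) := by
  unfold measAeta; infer_instance

/-- The incidence set `{(z, u) : z ∈ D_{u,r}}`. -/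
def incid (r : ℝ) : Set (ℂ × ℂ) := {p | ‖p.1‖ < 1 ∧ ‖p.1 - p.2‖ < r * (1 - ‖p.2‖)}

lemma incid_meas (r : ℝ) : MeasurableSet (incid r) := by
  have h1 : MeasurableSet {p : ℂ × ℂ | ‖p.1‖ < 1} :=
    measurableSet_lt (by fun_prop) (by fun_prop)
  have h2 : MeasurableSet {p : ℂ × ℂ | ‖p.1 - p.2‖ < r * (1 - ‖p.2‖)} :=
    measurableSet_lt (by fun_prop) (by fun_prop)
  exact h1.inter h2

lemma ae_areaM_ball : ∀ᵐ z ∂areaM, ‖z‖ < 1 := by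
  rw [← areaM_restrict_ball]
  refine (ae_restrict_iff' measurableSet_ball).2 (Filter.Eventually.of_forall fun z hz => ?_)
  simpa using hz

lemma pointwise_G (n : ℕ) {r : ℝ} (hr : 0 < r) (hr1 : r < 1) {f : ℂ → K}
    (hf : DifferentiableOn ℂ f (ball (0 : ℂ) 1)) {A : K →L[ℂ] K} (hA : A.IsPositive)
    {z : ℂ} (hz : ‖z‖ < 1) :
    ENNReal.ofReal (A.reApplyInnerSelf (iteratedDeriv n f z)) ≤
      ∫⁻ u in ball (0:ℂ) 1, (incid r).indicator (fun p =>
        ENNReal.ofReal (((n.factorial : ℝ) ^ 2 * 2 ^ (2 * n) * 4) * (4 / r) ^ (2 * n + 2) *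
          ((1 - ‖p.2‖) ^ (2 * n + 2))⁻¹) *
        ENNReal.ofReal (A.reApplyInnerSelf ((ball (0:ℂ) 1).indicator f p.2))) (z, u) := by
  obtain ⟨S, hS, hSA⟩ := exists_pos_sqrt A hA
  set C1 : ℝ := (n.factorial : ℝ) ^ 2 * 2 ^ (2 * n) * 4 with hC1
  have hδ : 0 < 1 - ‖z‖ := by linarith
  set R := r / 2 * (1 - ‖z‖) with hR
  have hR0 : 0 < R := by positivity
  have hsubc : closedBall z R ⊆ ball (0:ℂ) 1 := closedBall_sub hz (by linarith)
  have hsub : ball z R ⊆ ball (0:ℂ) 1 := ball_subset_closedBall.trans hsubc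
  have hSf : DifferentiableOn ℂ (fun u => S (f u)) (ball (0:ℂ) 1) :=
    S.differentiable.comp_differentiableOn hf
  have h1 := deriv_area_est n hR0 (hSf.mono hsubc)
  rw [iteratedDeriv_clm_comp S isOpen_ball hf n z (by simpa using hz), ← hC1] at h1
  have hi : IntegrableOn (fun u => ‖S (f u)‖ ^ 2) (ball z R) :=
    (((hSf.mono hsubc).continuousOn.norm.pow 2).integrableOn_compact
      (isCompact_closedBall _ _)).mono_set ball_subset_closedBall
  rw [reApply_of_sq hS hSA]
  calc ENNReal.ofReal (‖S (iteratedDeriv n f z)‖ ^ 2)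
      ≤ ENNReal.ofReal (C1 * (R ^ (2 * n + 2))⁻¹ * ∫ u in ball z R, ‖S (f u)‖ ^ 2) :=
        ENNReal.ofReal_le_ofReal h1
    _ = ∫⁻ u in ball z R, ENNReal.ofReal (C1 * (R ^ (2 * n + 2))⁻¹) *
          ENNReal.ofReal (‖S (f u)‖ ^ 2) := by
        rw [ENNReal.ofReal_mul (by positivity), ofReal_integral_eq_lintegral_ofReal hi
          (by filter_upwards with u; positivity), lintegral_const_mul' _ _ ENNReal.ofReal_ne_top]
    _ ≤ ∫⁻ u in ball z R, (incid r).indicator (fun p =>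
        ENNReal.ofReal (C1 * (4 / r) ^ (2 * n + 2) * ((1 - ‖p.2‖) ^ (2 * n + 2))⁻¹) *
        ENNReal.ofReal (A.reApplyInnerSelf ((ball (0:ℂ) 1).indicator f p.2))) (z, u) := by
        refine setLIntegral_mono' measurableSet_ball fun u hu => ?_
        have hu1 : u ∈ ball (0:ℂ) 1 := hsub hu
        have hun : ‖u‖ < 1 := by simpa using hu1
        have huz : ‖u - z‖ < R := by simpa [dist_eq_norm] using hu
        have hδu : 0 < 1 - ‖u‖ := by linarith
        have n1 := norm_sub_norm_le u z
        have n2 := norm_sub_norm_le z u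
        have n3 : ‖z - u‖ = ‖u - z‖ := norm_sub_rev _ _
        have hmem : (z, u) ∈ incid r := by
          refine ⟨hz, ?_⟩
          change ‖z - u‖ < r * (1 - ‖u‖)
          rw [n3]
          rw [hR] at huz
          nlinarith
        rw [Set.indicator_of_mem hmem]
        simp only
        rw [Set.indicator_of_mem hu1, reApply_of_sq hS hSA]
        gcongr ?_ * _
        apply ENNReal.ofReal_le_ofReal
        rw [mul_assoc C1 ((4 / r) ^ (2 * n + 2)), ← inv_pow, ← inv_pow, ← mul_pow]
        gcongr
        rw [inv_le_comm₀ hR0 (by positivity)]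
        have : (4 / r * (1 - ‖u‖)⁻¹)⁻¹ = r / 4 * (1 - ‖u‖) := by field_simp
        rw [this, hR]
        have h5 : 1 - ‖u‖ ≤ 2 * (1 - ‖z‖) := by
          rw [hR] at huz
          nlinarith
        nlinarith
    _ ≤ _ := lintegral_mono_set hsub

lemma inner_kernel {r : ℝ} (hr : 0 < r) (hr1 : r < 1) {C3 : ℝ} (hC3 : 0 ≤ C3) {w : ℂ}
    (hw : ‖w‖ < 1) :
    ∫⁻ u in ball (0:ℂ) 1, (incid r).indicator (fun p =>
      ENNReal.ofReal (C3 * ((1 - ‖p.2‖) ^ 2)⁻¹)) (w, u) ≤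
      ENNReal.ofReal (C3 * 4 * Real.pi * ((1 - r) ^ 2)⁻¹) := by
  have hδ : 0 < 1 - ‖w‖ := by linarith
  have h1r : 0 < 1 - r := by linarith
  have hpi := Real.pi_pos
  set B := ball w ((1 - ‖w‖) / (1 - r)) with hB
  calc _ ≤ ∫⁻ u in ball (0:ℂ) 1, B.indicator (fun _ =>
        ENNReal.ofReal (C3 * (4 * ((1 - ‖w‖) ^ 2)⁻¹))) u := by
        refine setLIntegral_mono' measurableSet_ball fun u hu => ?_
        by_cases hm : (w, u) ∈ incid r
        · rw [Set.indicator_of_mem hm]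
          have h2 : ‖w - u‖ < r * (1 - ‖u‖) := hm.2
          have hun : ‖u‖ < 1 := by simpa using hu
          have hδu : 0 < 1 - ‖u‖ := by linarith
          have n1 := norm_sub_norm_le w u
          have n2 := norm_sub_norm_le u w
          have n3 : ‖u - w‖ = ‖w - u‖ := norm_sub_rev _ _
          have hmem : u ∈ B := by
            rw [hB, mem_ball, dist_eq_norm, n3, lt_div_iff₀ h1r]
            nlinarith
          rw [Set.indicator_of_mem hmem]
          apply ENNReal.ofReal_le_ofReal
          gcongr
          have h5 : 1 - ‖w‖ ≤ 2 * (1 - ‖u‖) := by nlinarith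
          have h6 : (1 - ‖w‖) ^ 2 ≤ 4 * (1 - ‖u‖) ^ 2 := by nlinarith
          rw [← div_eq_mul_inv, le_div_iff₀ (by positivity), inv_mul_le_iff₀ (by positivity)]
          linarith
        · rw [Set.indicator_of_notMem hm]; exact zero_le
    _ ≤ ∫⁻ u, B.indicator (fun _ =>
        ENNReal.ofReal (C3 * (4 * ((1 - ‖w‖) ^ 2)⁻¹))) u := setLIntegral_le_lintegral _ _
    _ = ENNReal.ofReal (C3 * (4 * ((1 - ‖w‖) ^ 2)⁻¹)) * volume B := by
        rw [lintegral_indicator measurableSet_ball, setLIntegral_const]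
    _ = _ := by
        rw [hB, Complex.volume_ball]
        have : (NNReal.pi : ℝ≥0∞) = ENNReal.ofReal Real.pi := by
          rw [← NNReal.coe_real_pi, ENNReal.ofReal_coe_nnreal]
        rw [this, ← ENNReal.ofReal_pow (by positivity), ← ENNReal.ofReal_mul (by positivity),
          ← ENNReal.ofReal_mul (by positivity)]
        congr 1
        field_simp

end Final

/-- Sufficiency in the Carleson embedding theorem for vector-valued Bergman spaces:
the Carleson condition `∫_{D_{λ,r}} G dA ≤ c (1−|λ|)^{2n} ∫_{D_{λ,r}} W dA_η` implies
`∫ ⟨G f⁽ⁿ⁾, f⁽ⁿ⁾⟩ dA ≲ ∫ ⟨W f, f⟩ dA_η` for all `f ∈ L²_a(H, W dA_η)`. -/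
theorem carleson_embedding_sufficiency (η : ℝ) (hη : -1 < η) (r : ℝ) (hr : 0 < r)
    (hr1 : r < 1) (n : ℕ) (G W Winv : ℂ → H →L[ℂ] H)
    (hGpos : ∀ z : ℂ, ‖z‖ < 1 → (G z).IsPositive)
    (hGint : ∃ TG : H →L[ℂ] H, IsWeakOpIntegral areaM G (ball (0 : ℂ) 1) TG)
    (hW : IsB2Weight η W Winv) (c : ℝ)
    (hcar : ∀ lam : ℂ, ‖lam‖ < 1 → ∀ TG TW : H →L[ℂ] H,
      IsWeakOpIntegral areaM G (discAt lam r) TG →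
      IsWeakOpIntegral (measAeta η) W (discAt lam r) TW →
      ∀ e : H, TG.reApplyInnerSelf e ≤ c * (1 - ‖lam‖) ^ (2 * n) * TW.reApplyInnerSelf e) :
    ∃ C : ℝ, ∀ f : ℂ → H, DifferentiableOn ℂ f (ball (0 : ℂ) 1) →
      Integrable (fun z => (W z).reApplyInnerSelf (f z)) (measAeta η) →
      ∫ z, (G z).reApplyInnerSelf (iteratedDeriv n f z) ∂areaM ≤
        C * ∫ z, (W z).reApplyInnerSelf (f z) ∂(measAeta η) := by
  classical
  obtain ⟨C0, hC0, hav⟩ := averaging η hη hr hr1 hW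
  have hWp : ∀ᵐ z ∂(measAeta η), (W z).IsPositive :=
    ae_measAeta (by filter_upwards [hW.1] with z hz using hz.1)
  have hGp : ∀ᵐ z ∂areaM, (G z).IsPositive := by
    filter_upwards [ae_areaM_ball] with z hz using hGpos z hz
  obtain ⟨TG0, hTG0⟩ := hGint
  obtain ⟨-, ⟨TW0, hTW0, -⟩, -, -⟩ := hW
  have hGi : ∀ x, AEMeasurable (fun z => (G z).reApplyInnerSelf x) areaM := by
    intro x
    have h := hTG0
    unfold IsWeakOpIntegral at h
    rw [areaM_restrict_ball] at h
    exact (reApply_integrable (fun x y => (h x y).1) x).aemeasurable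
  have h1r : 0 < 1 - r := by linarith
  have hpi := Real.pi_pos
  set C2 : ℝ := ((n.factorial : ℝ) ^ 2 * 2 ^ (2 * n) * 4) * (4 / r) ^ (2 * n + 2) with hC2
  have hC20 : 0 ≤ C2 := by positivity
  set C3 : ℝ := C2 * |c| * C0 with hC3
  have hC30 : 0 ≤ C3 := by positivity
  set C4 : ℝ := C3 * 4 * Real.pi * ((1 - r) ^ 2)⁻¹ with hC4
  have hC40 : 0 ≤ C4 := by positivity
  refine ⟨C4, fun f hf hfi => ?_⟩
  set ν : Measure ℂ := volume.restrict (ball (0:ℂ) 1) with hν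
  have hfm : StronglyMeasurable ((ball (0:ℂ) 1).indicator f) := by
    have hsm : StronglyMeasurable ((ball (0:ℂ) 1).domRestrict f) :=
      (continuousOn_iff_continuous_domRestrict.1 hf.continuousOn).stronglyMeasurable
    refine stronglyMeasurable_of_restrict_of_restrict_compl (s := ball (0:ℂ) 1) measurableSet_ball ?_ ?_
    · convert hsm using 1
      ext x
      exact Set.indicator_of_mem x.2 f
    · have : (ball (0:ℂ) 1)ᶜ.domRestrict ((ball (0:ℂ) 1).indicator f) = fun _ => 0 := by
        ext x
        exact Set.indicator_of_notMem x.2 f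
      rw [this]
      exact stronglyMeasurable_const
  -- first kernel
  set k1 : ℂ → ℂ → ℝ≥0∞ := fun z u => (incid r).indicator (fun p =>
        ENNReal.ofReal (C2 * ((1 - ‖p.2‖) ^ (2 * n + 2))⁻¹) *
        ENNReal.ofReal ((G p.1).reApplyInnerSelf ((ball (0:ℂ) 1).indicator f p.2))) (z, u) with hk1
  have hk1m : AEMeasurable (Function.uncurry k1) (areaM.prod ν) := by
    have : Function.uncurry k1 = (incid r).indicator (fun p : ℂ × ℂ =>
        ENNReal.ofReal (C2 * ((1 - ‖p.2‖) ^ (2 * n + 2))⁻¹) *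
        ENNReal.ofReal ((G p.1).reApplyInnerSelf ((ball (0:ℂ) 1).indicator f p.2))) := by
      ext ⟨z, u⟩; rfl
    rw [this]
    refine AEMeasurable.indicator ?_ (incid_meas r)
    have a : AEMeasurable (fun p : ℂ × ℂ =>
        ENNReal.ofReal (C2 * ((1 - ‖p.2‖) ^ (2 * n + 2))⁻¹)) (areaM.prod ν) :=
      Measurable.aemeasurable (by fun_prop)
    have b : AEMeasurable (fun p : ℂ × ℂ =>
        ENNReal.ofReal ((G p.1).reApplyInnerSelf ((ball (0:ℂ) 1).indicator f p.2)))
        (areaM.prod ν) := (joint_aemeasurable hGi hfm).ennreal_ofReal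
    exact a.mul b
  set k2 : ℂ → ℂ → ℝ≥0∞ := fun u w => (incid r).indicator (fun p =>
        ENNReal.ofReal (C3 * ((1 - ‖p.2‖) ^ 2)⁻¹)) (w, u) *
        ENNReal.ofReal ((W w).reApplyInnerSelf (f w)) with hk2
  have hk2m : AEMeasurable (Function.uncurry k2) (ν.prod (measAeta η)) := by
    have h1 : Measurable (fun p : ℂ × ℂ => (incid r).indicator (fun p =>
        ENNReal.ofReal (C3 * ((1 - ‖p.2‖) ^ 2)⁻¹)) (p.2, p.1)) :=
      (Measurable.indicator (by fun_prop) (incid_meas r)).comp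
        (measurable_snd.prodMk measurable_fst)
    exact h1.aemeasurable.mul (hfi.aemeasurable.comp_snd).ennreal_ofReal
  have hstepA : ∫⁻ z, ENNReal.ofReal ((G z).reApplyInnerSelf (iteratedDeriv n f z)) ∂areaM ≤
      ∫⁻ z, ∫⁻ u, k1 z u ∂ν ∂areaM := by
    refine lintegral_mono_ae ?_
    filter_upwards [ae_areaM_ball] with z hz
    exact pointwise_G n hr hr1 hf (hGpos z hz) hz
  have hstepB : ∫⁻ u, ∫⁻ z, k1 z u ∂areaM ∂ν ≤ ∫⁻ u, ∫⁻ w, k2 u w ∂(measAeta η) ∂ν := by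
    refine setLIntegral_mono' measurableSet_ball fun u hu => ?_
    have hun : ‖u‖ < 1 := by simpa using hu
    have hδ : 0 < 1 - ‖u‖ := by linarith
    obtain ⟨TG, hTG⟩ := weak_exists_of_ball areaM_restrict_ball hGp hTG0 (discAt u r)
    obtain ⟨TW, hTW⟩ := weak_exists_of_ball (measAeta_restrict_ball η) hWp hTW0 (discAt u r)
    have hDm : MeasurableSet (discAt u r) := by
      rw [discAt_eq hun hr1]; exact measurableSet_ball
    have hTWp := (weak_pos hWp hTW).2 (f u)
    have h1 := hcar u hun TG TW hTG hTW (f u)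
    have h2 := hav f hf hfi u hun TW hTW
    have hcc : c * (1 - ‖u‖) ^ (2 * n) * TW.reApplyInnerSelf (f u) ≤
        |c| * (1 - ‖u‖) ^ (2 * n) * TW.reApplyInnerSelf (f u) := by
      gcongr
      exact le_abs_self c
    set J := ∫ z in discAt u r, (W z).reApplyInnerSelf (f z) ∂(measAeta η) with hJ
    have hL : ∫⁻ z, k1 z u ∂areaM = ENNReal.ofReal (C2 * ((1 - ‖u‖) ^ (2 * n + 2))⁻¹) *
        ENNReal.ofReal (TG.reApplyInnerSelf (f u)) := by
      rw [← weak_lintegral hGp hTG, ← lintegral_const_mul' _ _ ENNReal.ofReal_ne_top,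
        ← lintegral_indicator hDm]
      refine lintegral_congr fun z => ?_
      rw [hk1]
      by_cases hz : z ∈ discAt u r
      · rw [Set.indicator_of_mem hz]
        simp only
        rw [Set.indicator_of_mem (show (z, u) ∈ incid r from hz)]
        simp only
        rw [Set.indicator_of_mem hu]
      · rw [Set.indicator_of_notMem hz]
        simp only
        rw [Set.indicator_of_notMem (show (z, u) ∉ incid r from hz)]
    have hR : ∫⁻ w, k2 u w ∂(measAeta η) = ENNReal.ofReal (C3 * ((1 - ‖u‖) ^ 2)⁻¹) *
        ENNReal.ofReal J := by
      rw [hJ, ofReal_integral_eq_lintegral_ofReal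
        (hfi.mono_measure Measure.restrict_le_self)
        (by filter_upwards [ae_restrict_of_ae hWp] with z hz using hz.2 _),
        ← lintegral_const_mul' _ _ ENNReal.ofReal_ne_top, ← lintegral_indicator hDm]
      refine lintegral_congr fun z => ?_
      rw [hk2]
      by_cases hz : z ∈ discAt u r
      · rw [Set.indicator_of_mem hz]
        simp only
        rw [Set.indicator_of_mem (show (z, u) ∈ incid r from hz)]
      · rw [Set.indicator_of_notMem hz]
        simp only
        rw [Set.indicator_of_notMem (show (z, u) ∉ incid r from hz), zero_mul]
    rw [hL, hR, ← ENNReal.ofReal_mul (by positivity), ← ENNReal.ofReal_mul (by positivity)]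
    apply ENNReal.ofReal_le_ofReal
    calc C2 * ((1 - ‖u‖) ^ (2 * n + 2))⁻¹ * TG.reApplyInnerSelf (f u)
        ≤ C2 * ((1 - ‖u‖) ^ (2 * n + 2))⁻¹ * (|c| * (1 - ‖u‖) ^ (2 * n) * (C0 * J)) := by
          gcongr
          exact (h1.trans hcc).trans (by gcongr)
      _ = C3 * ((1 - ‖u‖) ^ 2)⁻¹ * J := by
          rw [hC3, pow_add]
          field_simp
  have hstepC : ∫⁻ w, ∫⁻ u, k2 u w ∂ν ∂(measAeta η) ≤
      ENNReal.ofReal C4 * ∫⁻ w, ENNReal.ofReal ((W w).reApplyInnerSelf (f w)) ∂(measAeta η) := by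
    rw [← lintegral_const_mul' _ _ ENNReal.ofReal_ne_top]
    refine lintegral_mono_ae ?_
    filter_upwards [ae_measAeta ae_areaM_ball] with w hw
    rw [hk2]
    simp only
    rw [lintegral_mul_const' _ _ ENNReal.ofReal_ne_top]
    gcongr
    exact inner_kernel hr hr1 hC30 hw
  have hW0 : 0 ≤ᵐ[measAeta η] fun w => (W w).reApplyInnerSelf (f w) := by
    filter_upwards [hWp] with z hz using hz.2 _
  have hI0 : 0 ≤ ∫ z, (W z).reApplyInnerSelf (f z) ∂(measAeta η) := integral_nonneg_of_ae hW0
  have hall : ∫⁻ z, ENNReal.ofReal ((G z).reApplyInnerSelf (iteratedDeriv n f z)) ∂areaM ≤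
      ENNReal.ofReal (C4 * ∫ z, (W z).reApplyInnerSelf (f z) ∂(measAeta η)) := by
    rw [ENNReal.ofReal_mul hC40, ofReal_integral_eq_lintegral_ofReal hfi hW0]
    refine hstepA.trans ?_
    rw [lintegral_lintegral_swap hk1m]
    refine hstepB.trans ?_
    rw [lintegral_lintegral_swap hk2m]
    exact hstepC
  by_cases hi : Integrable (fun z => (G z).reApplyInnerSelf (iteratedDeriv n f z)) areaM
  · rw [← ofReal_integral_eq_lintegral_ofReal hi
      (by filter_upwards [hGp] with z hz using hz.2 _)] at hall
    exact (ENNReal.ofReal_le_ofReal_iff (by positivity)).1 hall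
  · rw [integral_undef hi]
    positivity
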